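/- ω-Consistency of the naive theory of truth in TJK^{d+}: (1) If NT ⊢ φ(ṅ) for every natural number n (where ṅ is the numeral for n), then NT ∪ {∀vφ} ⊬ ⊥; and (2) if NT ⊢ ∃vφ, then NT ∪ {φ(ṅ)} ⊬ ⊥ for some natural number n. -/

import Mathlib

universe u v

namespace BQL

structure Signature : Type 1 where
  Const : Type
  Func : Type
  arityF : Func → ℕ
  Rel : Type
  arityR : Rel → ℕ

inductive Term (L : Signature) : Type
  | var : ℕ → Term L
  | const : L.Const → Term L
  | func : (f : L.Func) → (Fin (L.arityF f) → Term L) → Term L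

inductive Formula (L : Signature) : Type
  | top : Formula L
  | bot : Formula L
  | rel : (R : L.Rel) → (Fin (L.arityR R) → Term L) → Formula L
  | and : Formula L → Formula L → Formula L
  | or : Formula L → Formula L → Formula L
  | imp : Formula L → Formula L → Formula L
  | all : Formula L → Formula L
  | ex : Formula L → Formula L

variable {L : Signature}

namespace Term

/-- Shift all (free) variables of a term up by one. -/
def shiftUp : Term L → Term L
  | var n => var (n + 1)
  | const c => const c
  | func f ts => func f fun i => (ts i).shiftUp

/-- Apply a simultaneous substitution to a term. -/
def applySub (σ : ℕ → Term L) : Term L → Term L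
  | var n => σ n
  | const c => const c
  | func f ts => func f fun i => (ts i).applySub σ

/-- All variables of the term are `< k`. -/
def ClosedAt : Term L → ℕ → Prop
  | var n, k => n < k
  | const _, _ => True
  | func _ ts, k => ∀ i, (ts i).ClosedAt k

/-- A closed term. -/
def Closed (t : Term L) : Prop := t.ClosedAt 0

/-- The constant `c` occurs in the term. -/
def OccC (c : L.Const) : Term L → Prop
  | var _ => False
  | const d => d = c
  | func _ ts => ∃ i, (ts i).OccC c

end Term

/-- Lift a substitution under a binder. -/
def liftSub (σ : ℕ → Term L) : ℕ → Term L
  | 0 => .var 0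
  | n + 1 => (σ n).shiftUp

namespace Formula

/-- Apply a simultaneous substitution to a formula. -/
def applySub (σ : ℕ → Term L) : Formula L → Formula L
  | top => top
  | bot => bot
  | rel R ts => rel R fun i => (ts i).applySub σ
  | and φ ψ => and (φ.applySub σ) (ψ.applySub σ)
  | or φ ψ => or (φ.applySub σ) (ψ.applySub σ)
  | imp φ ψ => imp (φ.applySub σ) (ψ.applySub σ)
  | all φ => all (φ.applySub (liftSub σ))
  | ex φ => ex (φ.applySub (liftSub σ))

/-- All free variables of the formula are `< k`. -/
def ClosedAt : Formula L → ℕ → Prop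
  | top, _ => True
  | bot, _ => True
  | rel _ ts, k => ∀ i, (ts i).ClosedAt k
  | and φ ψ, k => φ.ClosedAt k ∧ ψ.ClosedAt k
  | or φ ψ, k => φ.ClosedAt k ∧ ψ.ClosedAt k
  | imp φ ψ, k => φ.ClosedAt k ∧ ψ.ClosedAt k
  | all φ, k => φ.ClosedAt (k + 1)
  | ex φ, k => φ.ClosedAt (k + 1)

/-- A sentence: a formula with no free variables. -/
def Sentence (φ : Formula L) : Prop := φ.ClosedAt 0

/-- The constant `c` occurs in the formula. -/
def OccC (c : L.Const) : Formula L → Prop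
  | top => False
  | bot => False
  | rel _ ts => ∃ i, (ts i).OccC c
  | and φ ψ => φ.OccC c ∨ ψ.OccC c
  | or φ ψ => φ.OccC c ∨ ψ.OccC c
  | imp φ ψ => φ.OccC c ∨ ψ.OccC c
  | all φ => φ.OccC c
  | ex φ => φ.OccC c

/-- The formula contains no occurrence of `∨` and no occurrence of `∃`. -/
def NoOrEx : Formula L → Prop
  | top => True
  | bot => True
  | rel _ _ => True
  | and φ ψ => φ.NoOrEx ∧ ψ.NoOrEx
  | or _ _ => False
  | imp φ ψ => φ.NoOrEx ∧ ψ.NoOrEx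
  | all φ => φ.NoOrEx
  | ex _ => False

end Formula

/-- Substitute the term `t` for the variable `v₀` (lowering the other variables). -/
def subst0 (φ : Formula L) (t : Term L) : Formula L :=
  φ.applySub fun n => match n with | 0 => t | n + 1 => .var n

/-- `□ⁿφ`, where `□φ` abbreviates `⊤ → φ`. -/
def boxN : ℕ → Formula L → Formula L
  | 0, φ => φ
  | n + 1, φ => .imp .top (boxN n φ)

/-- The conjunction of a finite list of formulas (`⋀∅ = ⊤`). -/
def conjL : List (Formula L) → Formula L
  | [] => .top
  | [φ] => φ
  | φ :: ψ :: l => .and φ (conjL (ψ :: l))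

/-- The language `L⁺`, obtained from `L` by adding countably many fresh constants `aᵢ`. -/
def Signature.plus (L : Signature) : Signature where
  Const := L.Const ⊕ ℕ
  Func := L.Func
  arityF := L.arityF
  Rel := L.Rel
  arityR := L.arityR

/-- The fresh constant `aᵢ` of `L⁺`. -/
def aconst (L : Signature) (i : ℕ) : Term L.plus := .const (Sum.inr i)

/-- Embedding of `L`-terms into `L⁺`-terms. -/
def Term.emb : Term L → Term L.plus
  | .var n => .var n
  | .const c => .const (Sum.inl c)
  | .func f ts => .func f fun i => (ts i).emb

/-- Embedding of `L`-formulas into `L⁺`-formulas. -/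
def Formula.emb : Formula L → Formula L.plus
  | .top => .top
  | .bot => .bot
  | .rel R ts => .rel R fun i => (ts i).emb
  | .and φ ψ => .and φ.emb ψ.emb
  | .or φ ψ => .or φ.emb ψ.emb
  | .imp φ ψ => .imp φ.emb ψ.emb
  | .all φ => .all φ.emb
  | .ex φ => .ex φ.emb

/-- The fresh constant `aᵢ` occurs in no member of `Γ`. -/
def FreshIn (i : ℕ) (Γ : Set (Formula L.plus)) : Prop :=
  ∀ ψ ∈ Γ, ¬ ψ.OccC (Sum.inr i)

/-- A Kripke `L`-model (the frame conditions are packaged in `KModel.Proper`). -/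
structure KModel (L : Signature) : Type (u + 1) where
  W : Type u
  acc : W → W → Prop
  D : Type u
  interpC : L.Const → D
  interpF : (f : L.Func) → (Fin (L.arityF f) → D) → D
  interpR : (R : L.Rel) → W → Set (Fin (L.arityR R) → D)

/-- The conditions on an `L`-model: nonempty set of worlds, transitive accessibility
relation, nonempty domain, and the persistence constraint. -/
def KModel.Proper (M : KModel.{u} L) : Prop :=
  Nonempty M.W ∧ Nonempty M.D ∧ Transitive M.acc ∧
    ∀ (R : L.Rel) (w u' : M.W), M.acc w u' → M.interpR R w ⊆ M.interpR R u'

/-- Prepend a value to a valuation. -/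
def vcons {α : Sort*} (d : α) (ρ : ℕ → α) : ℕ → α
  | 0 => d
  | n + 1 => ρ n

/-- Denotation of a term. -/
def Term.eval (M : KModel.{u} L) (ρ : ℕ → M.D) : Term L → M.D
  | .var n => ρ n
  | .const c => M.interpC c
  | .func f ts => M.interpF f fun i => (ts i).eval M ρ

/-- The satisfaction relation `w ⊩ φ(ā)`. -/
def Sat (M : KModel.{u} L) : M.W → (ℕ → M.D) → Formula L → Prop
  | _, _, .top => True
  | _, _, .bot => False
  | w, ρ, .rel R ts => (fun i => (ts i).eval M ρ) ∈ M.interpR R w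
  | w, ρ, .and φ ψ => Sat M w ρ φ ∧ Sat M w ρ ψ
  | w, ρ, .or φ ψ => Sat M w ρ φ ∨ Sat M w ρ ψ
  | w, ρ, .imp φ ψ => ∀ u', M.acc w u' → Sat M u' ρ φ → Sat M u' ρ ψ
  | w, ρ, .all φ => ∀ d, Sat M w (vcons d ρ) φ
  | w, ρ, .ex φ => ∃ d, Sat M w (vcons d ρ) φ

/-- Satisfaction of a sentence (under every valuation). -/
def SatS (M : KModel.{u} L) (w : M.W) (φ : Formula L) : Prop := ∀ ρ, Sat M w ρ φ

/-- `Γ ⊨ φ`: truth is preserved at every reflexive world of every `L`-model. -/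
def Models (Γ : Set (Formula L)) (φ : Formula L) : Prop :=
  ∀ M : KModel.{u} L, M.Proper → ∀ w : M.W, M.acc w w →
    (∀ ψ ∈ Γ, SatS M w ψ) → SatS M w φ

/-- `Γ : Δ ⊨ φ`: for every `L`-model, every reflexive world `w` and every world `u ≻ w`:
if `w ⊩ Γ` and `u ⊩ Δ` then `u ⊩ φ`. -/
def ModelsCtx (Γ Δ : Set (Formula L)) (φ : Formula L) : Prop :=
  ∀ M : KModel.{u} L, M.Proper → ∀ w u' : M.W, M.acc w w → M.acc w u' →
    (∀ ψ ∈ Γ, SatS M w ψ) → (∀ ψ ∈ Δ, SatS M u' ψ) → SatS M u' φ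

end BQL

namespace BQL

/-- `Prf L Γ Δ φ` formalizes `Γ : Δ ⊢ φ`: there is a proof of `φ` in the natural
deduction system `NBQL_CD^r` (over `L⁺`-sentences) whose open assumptions all belong
to `Γ ∪ Δ` and in which every open assumption occurring *unsafely* (i.e. in the right
main subproof of an application of `→`-Elim) belongs to `Γ`.  Assumptions may be
discharged only at safe occurrences, so discharge always happens in the `Δ` zone. -/
inductive Prf (L : Signature) :
    Set (Formula L.plus) → Set (Formula L.plus) → Formula L.plus → Prop
  | hyp {Γ Δ : Set (Formula L.plus)} {φ} : φ ∈ Γ ∪ Δ → φ.Sentence → Prf L Γ Δ φ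
  | weaken {Γ Γ' Δ Δ' φ} : Γ ⊆ Γ' → Δ ⊆ Δ' → Prf L Γ Δ φ → Prf L Γ' Δ' φ
  | topIntro {Γ Δ} : Prf L Γ Δ .top
  | botElim {Γ Δ φ} : φ.Sentence → Prf L Γ Δ .bot → Prf L Γ Δ φ
  | andIntro {Γ Δ φ ψ} : Prf L Γ Δ φ → Prf L Γ Δ ψ → Prf L Γ Δ (.and φ ψ)
  | andElimL {Γ Δ φ ψ} : Prf L Γ Δ (.and φ ψ) → Prf L Γ Δ φ
  | andElimR {Γ Δ φ ψ} : Prf L Γ Δ (.and φ ψ) → Prf L Γ Δ ψ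
  | orIntroL {Γ Δ φ ψ} : ψ.Sentence → Prf L Γ Δ φ → Prf L Γ Δ (.or φ ψ)
  | orIntroR {Γ Δ φ ψ} : φ.Sentence → Prf L Γ Δ ψ → Prf L Γ Δ (.or φ ψ)
  | orElim {Γ Δ φ ψ χ} : Prf L Γ Δ (.or φ ψ) → Prf L Γ (insert φ Δ) χ →
      Prf L Γ (insert ψ Δ) χ → Prf L Γ Δ χ
  | impIntro {Γ Δ φ ψ} : φ.Sentence → Prf L Γ (insert φ Δ) ψ → Prf L Γ Δ (.imp φ ψ)
  | impElim {Γ Δ φ ψ} : Prf L Γ Δ φ → Prf L Γ ∅ (.imp φ ψ) → Prf L Γ Δ ψ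
  | intTrans {Γ Δ φ ψ χ} : Prf L Γ Δ (.imp φ ψ) → Prf L Γ Δ (.imp ψ χ) →
      Prf L Γ Δ (.imp φ χ)
  | intAndIntro {Γ Δ φ ψ χ} : Prf L Γ Δ (.imp φ ψ) → Prf L Γ Δ (.imp φ χ) →
      Prf L Γ Δ (.imp φ (.and ψ χ))
  | intOrElim {Γ Δ φ ψ χ} : Prf L Γ Δ (.imp φ χ) → Prf L Γ Δ (.imp ψ χ) →
      Prf L Γ Δ (.imp (.or φ ψ) χ)
  | intAllIntro {Γ Δ φ ψ} : φ.Sentence → Prf L Γ Δ (.all (.imp φ ψ)) →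
      Prf L Γ Δ (.imp φ (.all ψ))
  | intExElim {Γ Δ φ ψ} : ψ.Sentence → Prf L Γ Δ (.all (.imp φ ψ)) →
      Prf L Γ Δ (.imp (.ex φ) ψ)
  | allIntro {Γ Δ Γ' Δ' φ} {i : ℕ} : Γ' ⊆ Γ → Δ' ⊆ Δ → FreshIn i Γ' → FreshIn i Δ' →
      ¬ φ.OccC (Sum.inr i) → Prf L Γ' Δ' (subst0 φ (aconst L i)) → Prf L Γ Δ (.all φ)
  | allElim {Γ Δ φ} {t : Term L.plus} : t.Closed → Prf L Γ Δ (.all φ) →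
      Prf L Γ Δ (subst0 φ t)
  | cd {Γ Δ φ ψ} : φ.Sentence → Prf L Γ Δ (.all (.or φ ψ)) → Prf L Γ Δ (.or φ (.all ψ))
  | exIntro {Γ Δ φ} {t : Term L.plus} : t.Closed → (Formula.ex φ).Sentence →
      Prf L Γ Δ (subst0 φ t) → Prf L Γ Δ (.ex φ)
  | exElim {Γ Δ Γ' Δ' φ ψ} {i : ℕ} : Γ' ⊆ Γ → Δ' ⊆ Δ → FreshIn i Γ' → FreshIn i Δ' →
      ¬ φ.OccC (Sum.inr i) → ¬ ψ.OccC (Sum.inr i) → Prf L Γ Δ (.ex φ) →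
      Prf L Γ' (insert (subst0 φ (aconst L i)) Δ') ψ → Prf L Γ Δ ψ

/-- `Γ ⊢ φ`: there is a proof of `φ` from `Γ` in `NBQL_CD^r`. -/
def Prv (L : Signature) (Γ : Set (Formula L.plus)) (φ : Formula L.plus) : Prop :=
  Prf L Γ ∅ φ

end BQL

namespace BQL

/-- Codes for primitive recursive functions (indices `e`). -/
inductive PR : ℕ → Type
  | zero : PR 0
  | succ : PR 1
  | proj : {n : ℕ} → Fin n → PR n
  | comp : {m n : ℕ} → PR m → (Fin m → PR n) → PR n
  | prec : {n : ℕ} → PR n → PR (n + 2) → PR (n + 1)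

/-- The relation symbols of `L_T`: identity `=` and truth `T`. -/
inductive LTRel : Type
  | eq : LTRel
  | tr : LTRel

/-- The language `L_T`: a constant `0`, an `n`-ary function symbol `f_e` for each
`n`-ary primitive recursive index `e`, a binary relation `=` and a unary relation `T`. -/
def LT : Signature where
  Const := Unit
  Func := Σ n : ℕ, PR n
  arityF := Sigma.fst
  Rel := LTRel
  arityR := fun R => match R with | .eq => 2 | .tr => 1

/-- The variable `vₙ`. -/
def v (n : ℕ) : Term LT := .var n

/-- The constant `0`. -/
def zeroT : Term LT := .const ()

/-- The successor function symbol `s`. -/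
def sFun : LT.Func := ⟨1, PR.succ⟩

/-- `s(t)`. -/
def sApp (t : Term LT) : Term LT := .func sFun (fun _ => t)

/-- The numeral `ṅ`. -/
def num : ℕ → Term LT
  | 0 => zeroT
  | n + 1 => sApp (num n)

/-- `t = u`. -/
def teq (t u : Term LT) : Formula LT := .rel LTRel.eq ![t, u]

/-- `T(t)`. -/
def tT (t : Term LT) : Formula LT := .rel LTRel.tr (fun _ => t)

/-- `φ ↔ ψ` abbreviates `(φ → ψ) ∧ (ψ → φ)`. -/
def iffF (φ ψ : Formula LT) : Formula LT := .and (.imp φ ψ) (.imp ψ φ)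

/-- A block of `n` universal quantifiers. -/
def alls : ℕ → Formula LT → Formula LT
  | 0, φ => φ
  | n + 1, φ => alls n (.all φ)

/-- A finite conjunction `⋀_{i<n} φᵢ` (with `⋀∅ = ⊤`). -/
def conjFin : (n : ℕ) → (Fin n → Formula LT) → Formula LT
  | 0, _ => .top
  | n + 1, f => .and (conjFin n fun i => f i.castSucc) (f (Fin.last n))

/-- A1: `∀x (x = x)`. -/
def axA1 : Formula LT := .all (teq (v 0) (v 0))

/-- A2: `∀x∀y (x = y → y = x)`. -/
def axA2 : Formula LT := .all (.all (.imp (teq (v 1) (v 0)) (teq (v 0) (v 1))))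

/-- A3: `∀x∀y∀z (x = y ∧ y = z → x = z)`. -/
def axA3 : Formula LT :=
  .all (.all (.all (.imp (.and (teq (v 2) (v 1)) (teq (v 1) (v 0)))
    (teq (v 2) (v 0)))))

/-- Ie: `∀x̄∀ȳ (⋀ᵢ xᵢ = yᵢ → f_e(x̄) = f_e(ȳ))`. -/
def axCongr (f : LT.Func) : Formula LT :=
  alls (f.1 + f.1)
    (.imp (conjFin f.1 fun i => teq (v (f.1 + (i : ℕ))) (v (i : ℕ)))
      (teq (.func f fun i => v (f.1 + (i : ℕ))) (.func f fun i => v (i : ℕ))))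

/-- A4: `∀x∀y (x = y ∧ T(x) → T(y))`. -/
def axA4 : Formula LT :=
  .all (.all (.imp (.and (teq (v 1) (v 0)) (tT (v 1))) (tT (v 0))))

/-- A5: `∀x (s(x) = 0 → ⊥)`. -/
def axA5 : Formula LT := .all (.imp (teq (sApp (v 0)) zeroT) .bot)

/-- A6: `∀x∀y (s(x) = s(y) → x = y)`. -/
def axA6 : Formula LT :=
  .all (.all (.imp (teq (sApp (v 1)) (sApp (v 0))) (teq (v 1) (v 0))))

/-- De: the defining equations of the primitive recursive function with index `e`
(no axioms for the successor `s`, which is governed by A5 and A6). -/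
def defAx : {n : ℕ} → PR n → Set (Formula LT)
  | _, .zero => {teq (.func ⟨0, PR.zero⟩ Fin.elim0) zeroT}
  | _, .succ => ∅
  | _, @PR.proj n i =>
      {alls n (teq (.func ⟨n, PR.proj i⟩ fun j => v (j : ℕ)) (v (i : ℕ)))}
  | _, @PR.comp m n g hs =>
      {alls n (teq (.func ⟨n, PR.comp g hs⟩ fun j => v (j : ℕ))
        (.func ⟨m, g⟩ fun k => .func ⟨n, hs k⟩ fun j => v (j : ℕ)))}
  | _, @PR.prec n g h =>
      { alls n (teq (.func ⟨n + 1, PR.prec g h⟩ (Fin.cons zeroT fun j => v (j : ℕ)))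
          (.func ⟨n, g⟩ fun j => v (j : ℕ))),
        alls (n + 1) (teq
          (.func ⟨n + 1, PR.prec g h⟩ (Fin.cons (sApp (v n)) fun j => v (j : ℕ)))
          (.func ⟨n + 2, h⟩ (Fin.cons (v n)
            (Fin.cons (.func ⟨n + 1, PR.prec g h⟩ (Fin.cons (v n) fun j => v (j : ℕ)))
              fun j => v (j : ℕ))))) }

/-- Ind: `∀x̄ [∀y(φ(y,x̄) → φ(s(y),x̄)) → (φ(0,x̄) → ∀y φ(y,x̄))]`, where the
variable `y` is `v₀` and `x̄` are `v₁, ..., v_k`. -/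
def axInd (k : ℕ) (φ : Formula LT) : Formula LT :=
  alls k (.imp
    (.all (.imp φ (φ.applySub fun n => match n with
      | 0 => sApp (v 0)
      | m + 1 => v (m + 1))))
    (.imp (subst0 φ zeroT) (.all φ)))

/-- TB: `T⌜φ⌝ ↔ φ`, where `⌜φ⌝` is the numeral for (the Gödel code of) `φ`. -/
def axTB (code : Formula LT → ℕ) (φ : Formula LT) : Formula LT :=
  iffF (tT (num (code φ))) φ

/-- The naive theory of truth `NT`, relative to a Gödel coding `code`. -/
def NT (code : Formula LT → ℕ) : Set (Formula LT) :=
  {axA1, axA2, axA3, axA4, axA5, axA6} ∪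
  (⋃ f : LT.Func, {axCongr f}) ∪
  (⋃ f : Σ n : ℕ, PR n, defAx f.2) ∪
  {ψ | ∃ (k : ℕ) (φ : Formula LT), φ.ClosedAt (k + 1) ∧ ψ = axInd k φ} ∪
  {ψ | ∃ φ : Formula LT, φ.Sentence ∧ ψ = axTB code φ}

end BQL

namespace BQL

section Semantics

variable {L : Signature}

theorem vcons_eval_shiftUp (M : KModel.{u} L) (ρ : ℕ → M.D) (d : M.D) (t : Term L) :
    t.shiftUp.eval M (vcons d ρ) = t.eval M ρ := by
  induction t with
  | var n => rfl
  | const c => rfl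
  | func f ts ih => simp only [Term.shiftUp, Term.eval, ih]

theorem Term.eval_applySub (M : KModel.{u} L) (ρ : ℕ → M.D) (σ : ℕ → Term L) (t : Term L) :
    (t.applySub σ).eval M ρ = t.eval M fun n => (σ n).eval M ρ := by
  induction t with
  | var n => rfl
  | const c => rfl
  | func f ts ih => simp only [Term.applySub, Term.eval, ih]

theorem eval_liftSub (M : KModel.{u} L) (ρ : ℕ → M.D) (d : M.D) (σ : ℕ → Term L) :
    (fun n => (liftSub σ n).eval M (vcons d ρ)) = vcons d fun n => (σ n).eval M ρ := by
  funext n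
  cases n with
  | zero => rfl
  | succ n => exact vcons_eval_shiftUp M ρ d (σ n)

theorem sat_applySub (M : KModel.{u} L) (φ : Formula L) :
    ∀ (w : M.W) (ρ : ℕ → M.D) (σ : ℕ → Term L),
      Sat M w ρ (φ.applySub σ) ↔ Sat M w (fun n => (σ n).eval M ρ) φ := by
  induction φ with
  | top => intros; rfl
  | bot => intros; rfl
  | rel R ts => intro w ρ σ; simp only [Formula.applySub, Sat, Term.eval_applySub]
  | and φ ψ ih₁ ih₂ => intro w ρ σ; simp only [Formula.applySub, Sat, ih₁, ih₂]
  | or φ ψ ih₁ ih₂ => intro w ρ σ; simp only [Formula.applySub, Sat, ih₁, ih₂]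
  | imp φ ψ ih₁ ih₂ => intro w ρ σ; simp only [Formula.applySub, Sat, ih₁, ih₂]
  | all φ ih => intro w ρ σ; simp only [Formula.applySub, Sat, ih, eval_liftSub]
  | ex φ ih => intro w ρ σ; simp only [Formula.applySub, Sat, ih, eval_liftSub]

theorem sat_subst0 (M : KModel.{u} L) (φ : Formula L) (w : M.W) (ρ : ℕ → M.D) (t : Term L) :
    Sat M w ρ (subst0 φ t) ↔ Sat M w (vcons (t.eval M ρ) ρ) φ := by
  have h : (fun n => Term.eval M ρ (match n with | 0 => t | n + 1 => .var n)) =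
      vcons (t.eval M ρ) ρ := by
    funext n
    cases n <;> rfl
  rw [subst0, sat_applySub, ← h]

theorem Term.ClosedAt.eval_congr {M : KModel.{u} L} {ρ ρ' : ℕ → M.D} {k : ℕ} {t : Term L}
    (ht : t.ClosedAt k) (h : ∀ n < k, ρ n = ρ' n) : t.eval M ρ = t.eval M ρ' := by
  induction t with
  | var n => exact h n ht
  | const c => rfl
  | func f ts ih => simp only [Term.eval, fun i => ih i (ht i)]

theorem vcons_congr {α : Type*} {ρ ρ' : ℕ → α} {k : ℕ} (h : ∀ n < k, ρ n = ρ' n) (d : α) :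
    ∀ n < k + 1, vcons d ρ n = vcons d ρ' n
  | 0, _ => rfl
  | n + 1, hn => h n (by omega)

theorem Formula.ClosedAt.sat_congr {M : KModel.{u} L} {φ : Formula L} :
    ∀ {k : ℕ} {w : M.W} {ρ ρ' : ℕ → M.D}, φ.ClosedAt k → (∀ n < k, ρ n = ρ' n) →
      (Sat M w ρ φ ↔ Sat M w ρ' φ) := by
  induction φ with
  | top => intros; rfl
  | bot => intros; rfl
  | rel R ts =>
    intro k w ρ ρ' hφ h
    simp only [Sat, fun i => (hφ i).eval_congr h]
  | and φ ψ ih₁ ih₂ =>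
    intro k w ρ ρ' hφ h
    simp only [Sat, ih₁ hφ.1 h, ih₂ hφ.2 h]
  | or φ ψ ih₁ ih₂ =>
    intro k w ρ ρ' hφ h
    simp only [Sat, ih₁ hφ.1 h, ih₂ hφ.2 h]
  | imp φ ψ ih₁ ih₂ =>
    intro k w ρ ρ' hφ h
    simp only [Sat, ih₁ hφ.1 h, ih₂ hφ.2 h]
  | all φ ih =>
    intro k w ρ ρ' hφ h
    exact forall_congr' fun d => ih hφ (vcons_congr h d)
  | ex φ ih =>
    intro k w ρ ρ' hφ h
    exact exists_congr fun d => ih hφ (vcons_congr h d)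

theorem Formula.Sentence.sat_iff {M : KModel.{u} L} {φ : Formula L} (hφ : φ.Sentence)
    {w : M.W} (ρ ρ' : ℕ → M.D) : Sat M w ρ φ ↔ Sat M w ρ' φ :=
  hφ.sat_congr fun _ hn => absurd hn (Nat.not_lt_zero _)

theorem Sat.persist {M : KModel.{u} L} (hM : M.Proper) {φ : Formula L} :
    ∀ {w w' : M.W} {ρ : ℕ → M.D}, M.acc w w' → Sat M w ρ φ → Sat M w' ρ φ := by
  obtain ⟨-, -, htrans, hpers⟩ := hM
  induction φ with
  | top => intros; trivial
  | bot => intro _ _ _ _ h; exact h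
  | rel R ts => intro w w' ρ h hs; exact hpers R w w' h hs
  | and φ ψ ih₁ ih₂ => intro w w' ρ h hs; exact ⟨ih₁ h hs.1, ih₂ h hs.2⟩
  | or φ ψ ih₁ ih₂ => intro w w' ρ h hs; exact hs.imp (ih₁ h) (ih₂ h)
  | imp φ ψ ih₁ ih₂ => intro w w' ρ h hs x hx; exact hs x (htrans h hx)
  | all φ ih => intro w w' ρ h hs d; exact ih h (hs d)
  | ex φ ih => intro w w' ρ h ⟨d, hd⟩; exact ⟨d, ih h hd⟩

open Classical in
/-- Reinterpret the constant `c` of a model as the element `d`. -/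
noncomputable abbrev KModel.setC (M : KModel.{u} L) (c : L.Const) (d : M.D) : KModel.{u} L where
  W := M.W
  acc := M.acc
  D := M.D
  interpC := fun c' => if c' = c then d else M.interpC c'
  interpF := M.interpF
  interpR := M.interpR

theorem KModel.Proper.setC {M : KModel.{u} L} (hM : M.Proper) (c : L.Const) (d : M.D) :
    (M.setC c d).Proper := hM

theorem Term.eval_setC (M : KModel.{u} L) (c : L.Const) (d : M.D) (ρ : ℕ → M.D) {t : Term L}
    (ht : ¬ t.OccC c) : t.eval (M.setC c d) ρ = t.eval M ρ := by
  induction t with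
  | var n => rfl
  | const c' => exact if_neg ht
  | func f ts ih =>
    simp only [Term.OccC, not_exists] at ht
    simp only [Term.eval, fun i => ih i (ht i)]

theorem sat_setC (M : KModel.{u} L) (c : L.Const) (d : M.D) {φ : Formula L} (hφ : ¬ φ.OccC c) :
    ∀ (w : M.W) (ρ : ℕ → M.D), Sat (M.setC c d) w ρ φ ↔ Sat M w ρ φ := by
  induction φ with
  | top => intros; rfl
  | bot => intros; rfl
  | rel R ts =>
    intro w ρ
    simp only [Formula.OccC, not_exists] at hφ
    simp only [Sat, fun i => Term.eval_setC M c d ρ (hφ i)]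
  | and φ ψ ih₁ ih₂ =>
    intro w ρ
    simp only [Formula.OccC, not_or] at hφ
    simp only [Sat, ih₁ hφ.1, ih₂ hφ.2]
  | or φ ψ ih₁ ih₂ =>
    intro w ρ
    simp only [Formula.OccC, not_or] at hφ
    simp only [Sat, ih₁ hφ.1, ih₂ hφ.2]
  | imp φ ψ ih₁ ih₂ =>
    intro w ρ
    simp only [Formula.OccC, not_or] at hφ
    simp only [Sat, ih₁ hφ.1, ih₂ hφ.2]
  | all φ ih => intro w ρ; exact forall_congr' fun d' => ih hφ w _
  | ex φ ih => intro w ρ; exact exists_congr fun d' => ih hφ w _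

theorem sat_setC_subst0 (M : KModel.{u} L.plus) (i : ℕ) (d : M.D) {φ : Formula L.plus}
    (hφ : ¬ φ.OccC (Sum.inr i)) (w : M.W) (ρ : ℕ → M.D) :
    Sat (M.setC (Sum.inr i) d) w ρ (subst0 φ (aconst L i)) ↔ Sat M w (vcons d ρ) φ := by
  have h : (aconst L i).eval (M.setC (Sum.inr i) d) ρ = d := if_pos rfl
  rw [sat_subst0, sat_setC M _ d hφ, h]

theorem FreshIn.sat_setC {Γ Γ' : Set (Formula L.plus)} {i : ℕ} (hΓ : Γ' ⊆ Γ)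
    (hi : FreshIn i Γ') {M : KModel.{u} L.plus} (d : M.D) {w : M.W} {ρ : ℕ → M.D}
    (h : ∀ ψ ∈ Γ, Sat M w ρ ψ) : ∀ ψ ∈ Γ', Sat (M.setC (Sum.inr i) d) w ρ ψ :=
  fun ψ hψ => (BQL.sat_setC M _ d (hi ψ hψ) w ρ).2 (h ψ (hΓ hψ))

/-- Soundness of `NBQL_CD^r`: assumptions in `Γ` are evaluated at a reflexive world `w`, those
in `Δ` at a world accessible from `w`. -/
theorem Prf.sound {Γ Δ : Set (Formula L.plus)} {φ : Formula L.plus} (h : Prf L Γ Δ φ) :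
    ∀ (M : KModel.{u} L.plus), M.Proper → ∀ (w w' : M.W) (ρ : ℕ → M.D), M.acc w w →
      M.acc w w' → (∀ ψ ∈ Γ, Sat M w ρ ψ) → (∀ ψ ∈ Δ, Sat M w' ρ ψ) → Sat M w' ρ φ := by
  induction h with
  | hyp hmem _ =>
    intro M hM w w' ρ _ hw' hΓ hΔ
    exact hmem.elim (fun h => (hΓ _ h).persist hM hw') (hΔ _)
  | weaken hΓ' hΔ' _ ih =>
    intro M hM w w' ρ hw hw' hΓ hΔ
    exact ih M hM w w' ρ hw hw' (fun ψ h => hΓ ψ (hΓ' h)) (fun ψ h => hΔ ψ (hΔ' h))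
  | topIntro => intros; trivial
  | botElim _ _ ih =>
    intro M hM w w' ρ hw hw' hΓ hΔ
    exact (ih M hM w w' ρ hw hw' hΓ hΔ).elim
  | andIntro _ _ ih₁ ih₂ =>
    intro M hM w w' ρ hw hw' hΓ hΔ
    exact ⟨ih₁ M hM w w' ρ hw hw' hΓ hΔ, ih₂ M hM w w' ρ hw hw' hΓ hΔ⟩
  | andElimL _ ih =>
    intro M hM w w' ρ hw hw' hΓ hΔ
    exact (ih M hM w w' ρ hw hw' hΓ hΔ).1
  | andElimR _ ih =>
    intro M hM w w' ρ hw hw' hΓ hΔ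
    exact (ih M hM w w' ρ hw hw' hΓ hΔ).2
  | orIntroL _ _ ih =>
    intro M hM w w' ρ hw hw' hΓ hΔ
    exact Or.inl (ih M hM w w' ρ hw hw' hΓ hΔ)
  | orIntroR _ _ ih =>
    intro M hM w w' ρ hw hw' hΓ hΔ
    exact Or.inr (ih M hM w w' ρ hw hw' hΓ hΔ)
  | orElim _ _ _ ih ih₁ ih₂ =>
    intro M hM w w' ρ hw hw' hΓ hΔ
    rcases ih M hM w w' ρ hw hw' hΓ hΔ with h | h
    · exact ih₁ M hM w w' ρ hw hw' hΓ (Set.forall_mem_insert.2 ⟨h, hΔ⟩)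
    · exact ih₂ M hM w w' ρ hw hw' hΓ (Set.forall_mem_insert.2 ⟨h, hΔ⟩)
  | impIntro _ _ ih =>
    intro M hM w w' ρ hw hw' hΓ hΔ x hx h
    exact ih M hM w x ρ hw (hM.2.2.1 hw' hx) hΓ
      (Set.forall_mem_insert.2 ⟨h, fun ψ hψ => (hΔ ψ hψ).persist hM hx⟩)
  | impElim _ _ ih₁ ih₂ =>
    intro M hM w w' ρ hw hw' hΓ hΔ
    exact ih₂ M hM w w ρ hw hw hΓ (fun _ h => h.elim) w' hw' (ih₁ M hM w w' ρ hw hw' hΓ hΔ)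
  | intTrans _ _ ih₁ ih₂ =>
    intro M hM w w' ρ hw hw' hΓ hΔ x hx h
    exact ih₂ M hM w w' ρ hw hw' hΓ hΔ x hx (ih₁ M hM w w' ρ hw hw' hΓ hΔ x hx h)
  | intAndIntro _ _ ih₁ ih₂ =>
    intro M hM w w' ρ hw hw' hΓ hΔ x hx h
    exact ⟨ih₁ M hM w w' ρ hw hw' hΓ hΔ x hx h, ih₂ M hM w w' ρ hw hw' hΓ hΔ x hx h⟩
  | intOrElim _ _ ih₁ ih₂ =>
    intro M hM w w' ρ hw hw' hΓ hΔ x hx h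
    exact h.elim (ih₁ M hM w w' ρ hw hw' hΓ hΔ x hx) (ih₂ M hM w w' ρ hw hw' hΓ hΔ x hx)
  | intAllIntro hφ _ ih =>
    intro M hM w w' ρ hw hw' hΓ hΔ x hx h d
    exact ih M hM w w' ρ hw hw' hΓ hΔ d x hx ((hφ.sat_iff _ _).1 h)
  | intExElim hψ _ ih =>
    intro M hM w w' ρ hw hw' hΓ hΔ x hx ⟨d, hd⟩
    exact (hψ.sat_iff _ _).1 (ih M hM w w' ρ hw hw' hΓ hΔ d x hx hd)
  | allIntro hΓ' hΔ' hiΓ hiΔ hiφ _ ih =>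
    intro M hM w w' ρ hw hw' hΓ hΔ d
    rw [← sat_setC_subst0 M _ d hiφ]
    exact ih _ (hM.setC _ d) w w' ρ hw hw' (hiΓ.sat_setC hΓ' d hΓ) (hiΔ.sat_setC hΔ' d hΔ)
  | allElim _ _ ih =>
    intro M hM w w' ρ hw hw' hΓ hΔ
    exact (sat_subst0 M _ w' ρ _).2 (ih M hM w w' ρ hw hw' hΓ hΔ _)
  | cd hφ _ ih =>
    intro M hM w w' ρ hw hw' hΓ hΔ
    refine or_iff_not_imp_left.2 fun h d => ?_
    exact (ih M hM w w' ρ hw hw' hΓ hΔ d).resolve_left fun h' => h ((hφ.sat_iff _ _).1 h')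
  | exIntro _ _ _ ih =>
    intro M hM w w' ρ hw hw' hΓ hΔ
    exact ⟨_, (sat_subst0 M _ w' ρ _).1 (ih M hM w w' ρ hw hw' hΓ hΔ)⟩
  | exElim hΓ' hΔ' hiΓ hiΔ hiφ hiψ _ _ ih₁ ih₂ =>
    intro M hM w w' ρ hw hw' hΓ hΔ
    obtain ⟨d, hd⟩ := ih₁ M hM w w' ρ hw hw' hΓ hΔ
    rw [← sat_setC_subst0 M _ d hiφ] at hd
    rw [← sat_setC M _ d hiψ]
    exact ih₂ _ (hM.setC _ d) w w' ρ hw hw' (hiΓ.sat_setC hΓ' d hΓ)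
      (Set.forall_mem_insert.2 ⟨hd, hiΔ.sat_setC hΔ' d hΔ⟩)

/-- Expand an `L`-model to an `L⁺`-model by interpreting the fresh constants by `c`. -/
abbrev KModel.expand (M : KModel.{u} L) (c : ℕ → M.D) : KModel.{u} L.plus where
  W := M.W
  acc := M.acc
  D := M.D
  interpC := Sum.elim M.interpC c
  interpF := M.interpF
  interpR := M.interpR

theorem Term.eval_emb (M : KModel.{u} L) (c ρ : ℕ → M.D) (t : Term L) :
    t.emb.eval (M.expand c) ρ = t.eval M ρ := by
  induction t with
  | var n => rfl
  | const c' => rfl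
  | func f ts ih => exact congrArg (M.interpF f) (funext ih)

theorem sat_emb (M : KModel.{u} L) (c : ℕ → M.D) (φ : Formula L) :
    ∀ (w : M.W) (ρ : ℕ → M.D), Sat (M.expand c) w ρ φ.emb ↔ Sat M w ρ φ := by
  induction φ with
  | top => intros; rfl
  | bot => intros; rfl
  | rel R ts =>
    intro w ρ
    have h := funext fun i => Term.eval_emb M c ρ (ts i)
    exact iff_of_eq (congrArg (· ∈ M.interpR R w) h)
  | and φ ψ ih₁ ih₂ => intro w ρ; simp only [Formula.emb, Sat, ih₁, ih₂]
  | or φ ψ ih₁ ih₂ => intro w ρ; simp only [Formula.emb, Sat, ih₁, ih₂]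
  | imp φ ψ ih₁ ih₂ => intro w ρ; simp only [Formula.emb, Sat, ih₁, ih₂]
  | all φ ih => intro w ρ; exact forall_congr' fun d => ih w _
  | ex φ ih => intro w ρ; exact exists_congr fun d => ih w _

theorem Prv.sound {Γ : Set (Formula L)} {φ : Formula L} (h : Prv L (Formula.emb '' Γ) φ.emb)
    {M : KModel.{u} L} (hM : M.Proper) {w : M.W} (hw : M.acc w w) (ρ : ℕ → M.D)
    (hΓ : ∀ ψ ∈ Γ, Sat M w ρ ψ) : Sat M w ρ φ := by
  rw [← sat_emb M ρ]
  refine Prf.sound h (M.expand ρ) hM w w ρ hw hw ?_ fun _ h => h.elim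
  rintro _ ⟨ψ, hψ, rfl⟩
  exact (sat_emb M ρ ψ w ρ).2 (hΓ ψ hψ)

end Semantics

section StandardModel

/-- The primitive recursive function with a given index. -/
def PR.eval : {n : ℕ} → PR n → (Fin n → ℕ) → ℕ
  | _, .zero, _ => 0
  | _, .succ, a => a 0 + 1
  | _, .proj i, a => a i
  | _, .comp g hs, a => g.eval fun k => (hs k).eval a
  | _, .prec g h, a => Nat.rec (g.eval (Fin.tail a))
      (fun k r => h.eval (Fin.cons k (Fin.cons r (Fin.tail a)))) (a 0)

/-- The model of `L_T` over the standard natural numbers, on the frame `(W, acc)`, in which `T`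
has the extension `E w` at the world `w`. -/
abbrev stdModel {W : Type} (acc : W → W → Prop) (E : W → Set ℕ) : KModel.{0} LT where
  W := W
  acc := acc
  D := ℕ
  interpC := fun _ => 0
  interpF := fun f a => f.2.eval a
  interpR := fun R => match R with
    | .eq => fun _ => {a : Fin 2 → ℕ | a 0 = a 1}
    | .tr => fun w => {a : Fin 1 → ℕ | a 0 ∈ E w}

variable {W : Type} {acc : W → W → Prop} {E : W → Set ℕ}

theorem stdModel_proper [Nonempty W] (hacc : ∀ ⦃x y z⦄, acc x y → acc y z → acc x z)
    (hE : ∀ w w', acc w w' → E w ⊆ E w') : (stdModel acc E).Proper := by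
  refine ⟨‹_›, ⟨(0 : ℕ)⟩, hacc, ?_⟩
  rintro (_ | _) w w' h
  · exact subset_rfl
  · exact fun a ha => hE w w' h ha

theorem sat_tT {w : W} {ρ : ℕ → ℕ} {t : Term LT} :
    Sat (stdModel acc E) w ρ (tT t) ↔ t.eval (stdModel acc E) ρ ∈ E w := Iff.rfl

theorem eval_sApp (ρ : ℕ → ℕ) (t : Term LT) :
    (sApp t).eval (stdModel acc E) ρ = (t.eval (stdModel acc E) ρ : ℕ) + 1 := rfl

theorem eval_num (ρ : ℕ → ℕ) (n : ℕ) : (num n).eval (stdModel acc E) ρ = n := by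
  induction n with
  | zero => rfl
  | succ n ih => rw [num, eval_sApp, ih]

theorem sat_alls {M : KModel.{u} LT} {w : M.W} {φ : Formula LT} (n : ℕ)
    (h : ∀ ρ, Sat M w ρ φ) (ρ : ℕ → M.D) : Sat M w ρ (alls n φ) := by
  induction n generalizing φ with
  | zero => exact h ρ
  | succ n ih => exact ih fun ρ d => h (vcons d ρ)

theorem sat_conjFin {M : KModel.{u} LT} {w : M.W} {ρ : ℕ → M.D} (n : ℕ)
    (f : Fin n → Formula LT) : Sat M w ρ (conjFin n f) ↔ ∀ i, Sat M w ρ (f i) := by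
  induction n with
  | zero => exact ⟨fun _ i => i.elim0, fun _ => trivial⟩
  | succ n ih => simp only [conjFin, Sat, ih, Fin.forall_fin_succ']

theorem sat_axCongr (f : LT.Func) (w : W) (ρ : ℕ → ℕ) :
    Sat (stdModel acc E) w ρ (axCongr f) := by
  refine sat_alls (M := stdModel acc E) _ ?_ ρ
  intro ρ x _ h
  rw [sat_conjFin] at h
  exact congrArg f.2.eval (funext h)

theorem sat_defAx {n : ℕ} (e : PR n) {ψ : Formula LT} (hψ : ψ ∈ defAx e) (w : W) (ρ : ℕ → ℕ) :
    Sat (stdModel acc E) w ρ ψ := by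
  cases e with
  | zero => rw [defAx, Set.mem_singleton_iff] at hψ; subst hψ; rfl
  | succ => exact hψ.elim
  | proj i =>
    rw [defAx, Set.mem_singleton_iff] at hψ
    subst hψ
    refine sat_alls (M := stdModel acc E) _ ?_ ρ
    exact fun ρ => rfl
  | comp g hs =>
    rw [defAx, Set.mem_singleton_iff] at hψ
    subst hψ
    refine sat_alls (M := stdModel acc E) _ ?_ ρ
    exact fun ρ => rfl
  | prec g h =>
    rcases hψ with rfl | rfl
    · refine sat_alls (M := stdModel acc E) _ ?_ ρ
      exact fun ρ => rfl
    · refine sat_alls (M := stdModel acc E) _ ?_ ρ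
      intro ρ
      refine congrArg h.eval (funext fun i => ?_)
      exact Fin.cases rfl (fun i => Fin.cases rfl (fun i => rfl) i) i

theorem sat_axInd (k : ℕ) (φ : Formula LT) (w : W) (ρ : ℕ → ℕ) :
    Sat (stdModel acc E) w ρ (axInd k φ) := by
  refine sat_alls (M := stdModel acc E) _ ?_ ρ
  intro ρ x _ hstep y hy h0 d
  rw [sat_subst0] at h0
  induction d with
  | zero => exact h0
  | succ d ih =>
    have h := (sat_applySub _ _ _ _ _).1 (hstep d y hy ih)
    convert h using 1
    funext n
    cases n <;> rfl

theorem sat_NT {code : Formula LT → ℕ}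
    (hE : ∀ φ : Formula LT, φ.Sentence → ∀ w ρ, code φ ∈ E w ↔ Sat (stdModel acc E) w ρ φ)
    {ψ : Formula LT} (hψ : ψ ∈ NT code) (w : W) (ρ : ℕ → ℕ) : Sat (stdModel acc E) w ρ ψ := by
  rcases hψ with (((h | h) | h) | ⟨k, φ, -, rfl⟩) | ⟨φ, hφ, rfl⟩
  · rcases h with rfl | rfl | rfl | rfl | rfl | rfl
    · exact fun d => rfl
    · exact fun d e x _ h => Eq.symm h
    · exact fun d e f x _ h => Eq.trans h.1 h.2
    · intro d e x _ h
      have h₁ : d = e := h.1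
      subst h₁
      exact h.2
    · exact fun d x _ h => Nat.succ_ne_zero d h
    · exact fun d e x _ h => Nat.succ_injective h
  · obtain ⟨f, rfl⟩ := Set.mem_iUnion.1 h
    exact sat_axCongr f w ρ
  · obtain ⟨f, hf⟩ := Set.mem_iUnion.1 h
    exact sat_defAx f.2 hf w ρ
  · exact sat_axInd k φ w ρ
  · have h : ∀ x, Sat (stdModel acc E) x ρ (tT (num (code φ))) ↔ Sat (stdModel acc E) x ρ φ :=
      fun x => by rw [sat_tT, eval_num, hE φ hφ]
    exact ⟨fun x _ => (h x).1, fun x _ => (h x).2⟩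

theorem eval_stdModel {W : Type} {acc acc' : W → W → Prop} {E E' : W → Set ℕ} (ρ : ℕ → ℕ) (t : Term LT) :
    t.eval (stdModel acc E) ρ = t.eval (stdModel acc' E') ρ := by
  induction t with
  | var n => rfl
  | const c => rfl
  | func f ts ih => exact congrArg f.2.eval (funext ih)

end StandardModel

/-- A family of predicates indexed by `X` on a linear order that does not inject into `X` has a
common point at which every predicate in the family holding at all earlier points holds. -/
theorem exists_forall_lt_imp {W X : Type} [LinearOrder W] (P : X → W → Prop)
    (hX : ∀ f : W → X, ¬ Function.Injective f) :
    ∃ κ, ∀ x, (∀ w < κ, P x w) → P x κ := by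
  by_contra! h
  choose f hf hf' using h
  refine hX f fun w w' hww' => ?_
  rcases lt_trichotomy w w' with h | h | h
  · exact absurd (hf w' w h) (hww' ▸ hf' w)
  · exact h
  · exact absurd (hf w w' h) (hww' ▸ hf' w')

theorem exists_wellOrder_not_injective (X : Type) :
    ∃ (W : Type) (_ : LinearOrder W) (_ : WellFoundedLT W),
      ∀ f : W → X, ¬ Function.Injective f := by
  obtain ⟨o, ho⟩ := exists_wellFoundedLT (Set X)
  exact ⟨Set X, o, ho, Function.cantor_injective⟩

section TruthExtension

variable {W : Type} [LinearOrder W]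

/-- If `w'` lies below `w`, the extensions of `T` agree below `w'`, and the extension at `w'`
includes the one at `w`, then satisfaction transfers from `w` to `w'`. -/
theorem sat_mono {φ : Formula LT} :
    ∀ {E E' : W → Set ℕ} {w w' : W} {ρ : ℕ → ℕ}, w' ≤ w → E w ⊆ E' w' →
      (∀ x < w', E x = E' x) →
      Sat (stdModel (· > ·) E) w ρ φ → Sat (stdModel (· > ·) E') w' ρ φ := by
  induction φ with
  | top => intros; trivial
  | bot => intro _ _ _ _ _ _ _ _ h; exact h
  | rel R ts =>
    intro E E' w w' ρ _ hE _ h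
    have ht := funext fun i => eval_stdModel (acc := (· > ·)) (E := E) (acc' := (· > ·))
      (E' := E') ρ (ts i)
    change _ ∈ (stdModel (· > ·) E').interpR R w'
    rw [← ht]
    cases R with
    | eq => exact h
    | tr => exact hE h
  | and φ ψ ih₁ ih₂ =>
    intro E E' w w' ρ hw hE h hs
    exact ⟨ih₁ hw hE h hs.1, ih₂ hw hE h hs.2⟩
  | or φ ψ ih₁ ih₂ =>
    intro E E' w w' ρ hw hE h hs
    exact hs.imp (ih₁ hw hE h) (ih₂ hw hE h)
  | imp φ ψ ih₁ ih₂ =>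
    intro E E' w w' ρ hw hE h hs x hx hφ
    have hEx := h x hx
    refine ih₂ le_rfl hEx.subset (fun y hy => h y (hy.trans hx)) (hs x (lt_of_lt_of_le hx hw) ?_)
    exact ih₁ le_rfl hEx.symm.subset (fun y hy => (h y (hy.trans hx)).symm) hφ
  | all φ ih => intro E E' w w' ρ hw hE h hs d; exact ih hw hE h (hs d)
  | ex φ ih => intro E E' w w' ρ hw hE h ⟨d, hd⟩; exact ⟨d, ih hw hE h hd⟩

/-- The (codes of) sentences true at `w` when `T` has extension `X` at `w` and extensions `E`
at the worlds below `w`. -/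
def truthStep (code : Formula LT → ℕ) (E : W → Set ℕ) (w : W) : Set ℕ →o Set ℕ where
  toFun X := {n | ∃ φ : Formula LT, φ.Sentence ∧ code φ = n ∧
    ∀ ρ, Sat (stdModel (· > ·) (Function.update E w X)) w ρ φ}
  monotone' X Y hXY := by
    rintro n ⟨φ, hφ, rfl, h⟩
    refine ⟨φ, hφ, rfl, fun ρ => sat_mono le_rfl ?_ (fun x hx => ?_) (h ρ)⟩
    · simpa using hXY
    · simp [hx.ne]

variable [WellFoundedLT W]

/-- The extensions of `T` obtained by taking the least fixed point at each world in turn. -/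
noncomputable def truthExt (code : Formula LT → ℕ) : W → Set ℕ :=
  (wellFounded_lt (α := W)).fix fun w E =>
    (truthStep code (fun x => if h : x < w then E x h else ∅) w).lfp

theorem truthExt_eq (code : Formula LT → ℕ) (w : W) :
    truthExt code w =
      (truthStep code (fun x => if x < w then truthExt code x else ∅) w).lfp := by
  rw [truthExt, WellFounded.fix_eq]
  simp only [dite_eq_ite]

theorem mem_truthExt {code : Formula LT → ℕ} {w : W} {n : ℕ} : n ∈ truthExt code w ↔
    ∃ φ : Formula LT, φ.Sentence ∧ code φ = n ∧
      ∀ ρ, Sat (stdModel (· > ·) (truthExt code)) w ρ φ := by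
  rw [truthExt_eq, ← OrderHom.map_lfp, ← truthExt_eq]
  refine exists_congr fun φ => and_congr_right fun _ => and_congr_right fun _ =>
    forall_congr' fun ρ => ⟨sat_mono le_rfl ?_ fun x hx => ?_, sat_mono le_rfl ?_ fun x hx => ?_⟩
  all_goals first | simp [hx.ne, hx] | simp

theorem truthExt_anti (code : Formula LT → ℕ) : Antitone (truthExt (W := W) code) := by
  intro w' w hw
  rcases hw.eq_or_lt with rfl | hw
  · rfl
  rw [truthExt_eq code w]
  refine OrderHom.lfp_le _ ?_
  rintro n ⟨φ, hφ, rfl, h⟩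
  refine mem_truthExt.2 ⟨φ, hφ, rfl, fun ρ => sat_mono hw.le ?_ (fun x hx => ?_) (h ρ)⟩
  · simp
  · simp [(hx.trans hw).ne, hx.trans hw]

theorem code_mem_truthExt {code : Formula LT → ℕ} (hcode : Function.Injective code)
    {φ : Formula LT} (hφ : φ.Sentence) (w : W) (ρ : ℕ → ℕ) :
    code φ ∈ truthExt code w ↔ Sat (stdModel (· > ·) (truthExt code)) w ρ φ := by
  rw [mem_truthExt]
  constructor
  · rintro ⟨ψ, -, hψ, h⟩
    exact hcode hψ ▸ h ρ
  · exact fun h => ⟨φ, hφ, rfl, fun ρ' => (hφ.sat_iff ρ ρ').1 h⟩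

end TruthExtension

/-- If every conditional that holds throughout the worlds below `κ` is respected at `κ`, then
making `κ` see itself does not affect satisfaction. -/
theorem sat_reflexive_iff {W : Type} [LinearOrder W] {E : W → Set ℕ} {κ : W}
    (hκ : ∀ (φ ψ : Formula LT) (ρ : ℕ → ℕ),
      (∀ w < κ, Sat (stdModel (· > ·) E) w ρ φ → Sat (stdModel (· > ·) E) w ρ ψ) →
        Sat (stdModel (· > ·) E) κ ρ φ → Sat (stdModel (· > ·) E) κ ρ ψ) (φ : Formula LT) :
    ∀ (w : W) (ρ : ℕ → ℕ),
      Sat (stdModel (fun x y => y < x ∨ x = κ ∧ y = κ) E) w ρ φ ↔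
        Sat (stdModel (· > ·) E) w ρ φ := by
  induction φ with
  | top => intros; rfl
  | bot => intros; rfl
  | rel R ts =>
    intro w ρ
    have ht := funext fun i => eval_stdModel (acc := fun x y => y < x ∨ x = κ ∧ y = κ) (E := E)
      (acc' := (· > ·)) (E' := E) ρ (ts i)
    exact iff_of_eq (congrArg (· ∈ (stdModel (· > ·) E).interpR R w) ht)
  | and φ ψ ih₁ ih₂ => intro w ρ; exact and_congr (ih₁ w ρ) (ih₂ w ρ)
  | or φ ψ ih₁ ih₂ => intro w ρ; exact or_congr (ih₁ w ρ) (ih₂ w ρ)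
  | imp φ ψ ih₁ ih₂ =>
    intro w ρ
    constructor
    · exact fun h x hx hφ => (ih₂ x ρ).1 (h x (Or.inl hx) ((ih₁ x ρ).2 hφ))
    · rintro h x (hx | ⟨hw, hx⟩) hφ
      · exact (ih₂ x ρ).2 (h x hx ((ih₁ x ρ).1 hφ))
      · rw [hx] at hφ ⊢
        rw [hw] at h
        exact (ih₂ κ ρ).2 (hκ φ ψ ρ h ((ih₁ κ ρ).1 hφ))
  | all φ ih => intro w ρ; exact forall_congr' fun d => ih w _
  | ex φ ih => intro w ρ; exact exists_congr fun d => ih w _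

/-- `NT` holds at a reflexive world of a model over the standard natural numbers. -/
theorem exists_stdModel_NT {code : Formula LT → ℕ} (hcode : Function.Injective code) :
    ∃ (W : Type) (acc : W → W → Prop) (E : W → Set ℕ) (κ : W),
      (stdModel acc E).Proper ∧ acc κ κ ∧
        ∀ ψ ∈ NT code, ∀ ρ, Sat (stdModel acc E) κ ρ ψ := by
  let X := Formula LT × Formula LT × (ℕ → ℕ)
  obtain ⟨W, _, _, hW⟩ := exists_wellOrder_not_injective X
  obtain ⟨κ, hκ⟩ := exists_forall_lt_imp (W := W) (fun (x : X) w =>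
    Sat (stdModel (· > ·) (truthExt code)) w x.2.2 x.1 →
      Sat (stdModel (· > ·) (truthExt code)) w x.2.2 x.2.1) hW
  have hiff := sat_reflexive_iff (E := truthExt code) fun φ ψ ρ => hκ (φ, ψ, ρ)
  have : Nonempty W := ⟨κ⟩
  refine ⟨W, fun x y => y < x ∨ x = κ ∧ y = κ, truthExt code, κ,
    stdModel_proper ?_ ?_, Or.inr ⟨rfl, rfl⟩, fun ψ hψ => sat_NT (fun _ hφ w ρ => ?_) hψ κ⟩
  · rintro x y z (h | ⟨hx, hy⟩) (h' | ⟨hy', hz⟩)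
    · exact Or.inl (h'.trans h)
    · exact Or.inl (by rwa [hz, ← hy'])
    · exact Or.inl (by rwa [hx, ← hy])
    · exact Or.inr ⟨hx, hz⟩
  · rintro x y (h | ⟨rfl, rfl⟩)
    · exact truthExt_anti code h.le
    · rfl
  · exact (code_mem_truthExt hcode hφ w ρ).trans (hiff _ w ρ).symm

/-- **ω-Consistency of `NT` in `TJK^{d+}`** (Theorem 28): relative to any (injective)
Gödel coding: (1) if `NT ⊢ φ(ṅ)` for every `n` then `NT ∪ {∀v φ} ⊬ ⊥`; and (2) if
`NT ⊢ ∃v φ` then `NT ∪ {φ(ṅ)} ⊬ ⊥` for some `n`.  Here `⊢` is derivability in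
`NBQL_CD^r` (which axiomatizes `TJK^{d+}`) over `L_T⁺`. -/
theorem omega_consistency (code : Formula LT → ℕ) (hcode : Function.Injective code)
    (φ : Formula LT) (hφ : φ.ClosedAt 1) :
    ((∀ n : ℕ, Prv LT (Formula.emb '' NT code) (Formula.emb (subst0 φ (num n)))) →
        ¬ Prv LT (insert (Formula.emb (.all φ)) (Formula.emb '' NT code)) .bot) ∧
    (Prv LT (Formula.emb '' NT code) (Formula.emb (.ex φ)) →
        ∃ n : ℕ,
          ¬ Prv LT (insert (Formula.emb (subst0 φ (num n))) (Formula.emb '' NT code))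
            .bot) := by
  obtain ⟨W, acc, E, κ, hM, hκ, hNT⟩ := exists_stdModel_NT hcode
  have hnum (n : ℕ) (ρ : ℕ → ℕ) : Sat (stdModel acc E) κ ρ (subst0 φ (num n)) ↔
      Sat (stdModel acc E) κ (vcons n ρ) φ := by
    rw [sat_subst0, eval_num]
  have hcons {χ : Formula LT} {ρ : ℕ → ℕ} (hχ : Sat (stdModel acc E) κ ρ χ) :
      ¬ Prv LT (insert χ.emb (Formula.emb '' NT code)) .bot := by
    intro h
    rw [← Set.image_insert_eq] at h
    exact Prv.sound (φ := .bot) h hM hκ ρ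
      (Set.forall_mem_insert.2 ⟨hχ, fun ψ hψ => hNT ψ hψ ρ⟩)
  constructor
  · intro h
    exact hcons (χ := .all φ) (ρ := fun _ => 0) fun d =>
      (hnum d _).1 ((h d).sound hM hκ _ fun ψ hψ => hNT ψ hψ _)
  · intro h
    obtain ⟨d, hd⟩ := Prv.sound (φ := .ex φ) h hM hκ (fun _ => (0 : ℕ)) fun ψ hψ => hNT ψ hψ _
    exact ⟨d, hcons ((hnum d _).2 hd)⟩

end BQL
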